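/- arXiv:2202.05428 — 4 statements merged into one kernel-verified Lean document; each statement's English description precedes it below -/
import Mathlib

section
/- Let 0 < p < q be reals, and set b = √(p/q) and λ = p + q − 2√(pq). Then the sequence m : ℕ → ℝ defined by m_j = j·b^j for j ≥ 1 satisfies the λ-invariance equations for the q-matrix of the killed M/M/1 queue: q·m_2 − (p+q)·m_1 = −λ·m_1, and p·m_{j−1} + q·m_{j+1} − (p+q)·m_j = −λ·m_j for every j ≥ 2. -/
/-- The sequence `m j = j * b^j` with `b = √(p/q)` is a `λ`-invariant measure
(with `λ = p + q - 2√(pq)`) for the q-matrix of the M/M/1 queue with arrival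
rate `p` and service rate `q`, killed at first hitting of 0. -/
theorem mm1_lambda_invariant_measure (p q : ℝ) (hp : 0 < p) (hpq : p < q)
    (b lam : ℝ) (hb : b = Real.sqrt (p / q)) (hlam : lam = p + q - 2 * Real.sqrt (p * q))
    (m : ℕ → ℝ) (hm : ∀ j : ℕ, 1 ≤ j → m j = (j : ℝ) * b ^ j) :
    q * m 2 - (p + q) * m 1 = -lam * m 1 ∧
      ∀ j : ℕ, 2 ≤ j →
        p * m (j - 1) + q * m (j + 1) - (p + q) * m j = -lam * m j := by
  have hq : 0 < q := hp.trans hpq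
  have hb0 : 0 ≤ b := hb ▸ Real.sqrt_nonneg _
  have hpb : p = q * b ^ 2 := by
    rw [hb, Real.sq_sqrt (by positivity)]
    field_simp
  have hsqrt : Real.sqrt (p * q) = q * b := by
    rw [show p * q = (q * b) ^ 2 by rw [hpb]; ring]
    exact Real.sqrt_sq (by positivity)
  rw [hsqrt] at hlam
  clear hb hsqrt
  subst hlam
  refine ⟨?_, fun j hj => ?_⟩
  · rw [hm 1 le_rfl, hm 2 one_le_two]
    push_cast
    ring
  · obtain ⟨k, rfl⟩ := Nat.exists_eq_add_of_le' hj
    rw [hm _ (by omega), hm _ (by omega), hm _ (by omega), show k + 2 - 1 = k + 1 by omega]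
    push_cast
    linear_combination ((k : ℝ) + 1) * b ^ (k + 1) * hpb
end

section
/- Let 0 < p < q be reals, and set b = √(p/q) and λ = p + q − 2√(pq). Then the sequence x : ℕ → ℝ defined by x_i = i·b^{−i} for i ≥ 1 satisfies the λ-invariance equations for the q-matrix of the killed M/M/1 queue: p·x_2 − (p+q)·x_1 = −λ·x_1, and q·x_{i−1} + p·x_{i+1} − (p+q)·x_i = −λ·x_i for every i ≥ 2. -/
/-- The sequence `x i = i * b^(-i)` with `b = √(p/q)` is a `λ`-invariant vector
(with `λ = p + q - 2√(pq)`) for the q-matrix of the M/M/1 queue with arrival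
rate `p` and service rate `q`, killed at first hitting of 0. -/
theorem mm1_lambda_invariant_vector (p q : ℝ) (hp : 0 < p) (hpq : p < q)
    (b lam : ℝ) (hb : b = Real.sqrt (p / q)) (hlam : lam = p + q - 2 * Real.sqrt (p * q))
    (x : ℕ → ℝ) (hx : ∀ i : ℕ, 1 ≤ i → x i = (i : ℝ) * b ^ (-(i : ℤ))) :
    p * x 2 - (p + q) * x 1 = -lam * x 1 ∧
      ∀ i : ℕ, 2 ≤ i →
        q * x (i - 1) + p * x (i + 1) - (p + q) * x i = -lam * x i := by
  have hq : 0 < q := hp.trans hpq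
  have hb0 : 0 < b := hb ▸ Real.sqrt_pos.mpr (div_pos hp hq)
  have hpb : p = q * b ^ 2 := by
    rw [hb, Real.sq_sqrt (div_pos hp hq).le]
    field_simp
  have hsqrt : Real.sqrt (p * q) = q * b := by
    rw [hpb, show q * b ^ 2 * q = (q * b) ^ 2 by ring, Real.sqrt_sq (mul_pos hq hb0).le]
  clear hb
  rw [hsqrt] at hlam
  subst hlam hpb
  constructor
  · rw [hx 1 le_rfl, hx 2 one_le_two]
    simp only [zpow_neg, zpow_natCast]
    field_simp
    push_cast
    ring
  · intro i hi
    obtain ⟨k, rfl⟩ := Nat.exists_eq_add_of_le' hi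
    rw [hx (k + 2) (by omega), hx (k + 2 - 1) (by omega), hx (k + 2 + 1) (by omega),
      show k + 2 - 1 = k + 1 by omega]
    simp only [zpow_neg, zpow_natCast]
    field_simp
    push_cast
    ring
end

section
/- Let 0 < p < q be reals, and set b = √(p/q) and λ = p + q − 2√(pq). If a sequence y : ℕ → ℝ satisfies both the boundary equation q·y_2 − (p+q)·y_1 = −λ·y_1 and the recurrence p·y_{j−1} + q·y_{j+1} − (p+q)·y_j = −λ·y_j for every j ≥ 2, then y_j = y_1·j·b^{j−1} for all j ≥ 1. In particular, the λ-invariant measure of the killed M/M/1 queue is unique up to a scalar multiple, and every positive solution is a positive multiple of m_j = j·b^j. -/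
/-- Any solution of the full `λ`-invariance equations (boundary equation at
`j = 1` plus interior recurrence for `j ≥ 2`) for the measure of the killed
M/M/1 queue satisfies `y j = y 1 * j * b^(j-1)`; in particular the
`λ`-invariant measure is unique up to scalar multiples, and every positive
solution is a positive multiple of `m j = j * b^j`. -/
theorem mm1_invariant_measure_unique (p q : ℝ) (hp : 0 < p) (hpq : p < q)
    (b lam : ℝ) (hb : b = Real.sqrt (p / q)) (hlam : lam = p + q - 2 * Real.sqrt (p * q))
    (y : ℕ → ℝ)
    (hb1 : q * y 2 - (p + q) * y 1 = -lam * y 1)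
    (hy : ∀ j : ℕ, 2 ≤ j →
      p * y (j - 1) + q * y (j + 1) - (p + q) * y j = -lam * y j) :
    (∀ j : ℕ, 1 ≤ j → y j = y 1 * (j : ℝ) * b ^ (j - 1)) ∧
      ((∀ j : ℕ, 1 ≤ j → 0 < y j) →
        ∃ c : ℝ, 0 < c ∧ ∀ j : ℕ, 1 ≤ j → y j = c * ((j : ℝ) * b ^ j)) := by
  have hq : 0 < q := hp.trans hpq
  have hb_pos : 0 < b := hb ▸ Real.sqrt_pos.2 (div_pos hp hq)
  have hpb : p = q * b ^ 2 := by
    rw [hb, Real.sq_sqrt (div_pos hp hq).le, mul_div_cancel₀ _ hq.ne']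
  have hsqrt : Real.sqrt (p * q) = q * b := by
    rw [show p * q = (q * b) ^ 2 by rw [hpb]; ring]
    exact Real.sqrt_sq (mul_pos hq hb_pos).le
  rw [hsqrt] at hlam
  have hy_two : y 2 = 2 * b * y 1 := by
    apply mul_left_cancel₀ hq.ne'
    rw [hlam] at hb1
    linear_combination hb1
  have hform : ∀ n : ℕ, y (n + 1) = y 1 * ((n + 1 : ℕ) : ℝ) * b ^ n := by
    intro n
    induction n using Nat.twoStepInduction with
    | zero => simp
    | one => rw [hy_two]; push_cast; ring
    | more n ih₀ ih₁ =>
      have h := hy (n + 2) (by omega)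
      rw [show n + 2 - 1 = n + 1 by omega, ih₀, ih₁, hlam, hpb] at h
      apply mul_left_cancel₀ hq.ne'
      push_cast at h ⊢
      linear_combination h
  have hsol : ∀ j : ℕ, 1 ≤ j → y j = y 1 * (j : ℝ) * b ^ (j - 1) := by
    intro j hj
    obtain ⟨n, rfl⟩ := Nat.exists_eq_add_of_le' hj
    exact hform n
  refine ⟨hsol, fun hpos => ⟨y 1 / b, div_pos (hpos 1 le_rfl) hb_pos, fun j hj => ?_⟩⟩
  obtain ⟨n, rfl⟩ := Nat.exists_eq_add_of_le' hj
  rw [hform n, pow_succ]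
  field_simp
end

section
/- Let 0 < p < q be reals, and set b = √(p/q) and λ = p + q − 2√(pq). If a sequence z : ℕ → ℝ satisfies both the boundary equation p·z_2 − (p+q)·z_1 = −λ·z_1 and the recurrence q·z_{i−1} + p·z_{i+1} − (p+q)·z_i = −λ·z_i for every i ≥ 2, then z_i = z_1·i·b^{1−i} for all i ≥ 1. In particular, the λ-invariant vector of the killed M/M/1 queue is unique up to a scalar multiple, and every positive solution is a positive multiple of x_i = i·b^{−i}. -/
/-- A sequence with `b * u 1 = 2 * u 0` and `u n + b ^ 2 * u (n + 2) = 2 * b * u (n + 1)` satisfies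
`b ^ n * u n = u 0 * (n + 1)`. -/
theorem pow_mul_eq_of_double_root_recurrence {R : Type*} [CommRing R] {b : R} {u : ℕ → R}
    (h0 : b * u 1 = 2 * u 0)
    (hu : ∀ n, u n + b ^ 2 * u (n + 2) = 2 * b * u (n + 1)) (n : ℕ) :
    b ^ n * u n = u 0 * (n + 1) := by
  induction n using Nat.twoStepInduction with
  | zero => simp
  | one => push_cast; linear_combination h0
  | more n ih1 ih2 =>
    push_cast at ih2 ⊢
    linear_combination b ^ n * hu n - ih1 + 2 * ih2

/-- Any solution of the full `λ`-invariance equations (boundary equation at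
`i = 1` plus interior recurrence for `i ≥ 2`) for the vector of the killed
M/M/1 queue satisfies `z i = z 1 * i * b^(1-i)`; in particular the
`λ`-invariant vector is unique up to scalar multiples, and every positive
solution is a positive multiple of `x i = i * b^(-i)`. -/
theorem mm1_invariant_vector_unique (p q : ℝ) (hp : 0 < p) (hpq : p < q)
    (b lam : ℝ) (hb : b = Real.sqrt (p / q)) (hlam : lam = p + q - 2 * Real.sqrt (p * q))
    (z : ℕ → ℝ)
    (hb1 : p * z 2 - (p + q) * z 1 = -lam * z 1)
    (hz : ∀ i : ℕ, 2 ≤ i →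
      q * z (i - 1) + p * z (i + 1) - (p + q) * z i = -lam * z i) :
    (∀ i : ℕ, 1 ≤ i → z i = z 1 * (i : ℝ) * b ^ ((1 : ℤ) - (i : ℤ))) ∧
      ((∀ i : ℕ, 1 ≤ i → 0 < z i) →
        ∃ c : ℝ, 0 < c ∧ ∀ i : ℕ, 1 ≤ i → z i = c * ((i : ℝ) * b ^ (-(i : ℤ)))) := by
  have hq : 0 < q := hp.trans hpq
  have hb0 : 0 < b := hb ▸ Real.sqrt_pos.2 (div_pos hp hq)
  have hbp : p = b ^ 2 * q := by
    rw [hb, Real.sq_sqrt (div_pos hp hq).le, div_mul_cancel₀ _ hq.ne']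
  have hpq' : Real.sqrt (p * q) = b * q := by
    rw [show p * q = (b * q) ^ 2 by rw [hbp]; ring, Real.sqrt_sq (by positivity)]
  have h0 : b * z 2 = 2 * z 1 := by
    apply mul_left_cancel₀ (mul_pos hb0 hq).ne'
    rw [hlam, hpq'] at hb1
    linear_combination hb1 - z 2 * hbp
  have hrec (n : ℕ) : z (n + 1) + b ^ 2 * z (n + 3) = 2 * b * z (n + 2) := by
    have h := hz (n + 2) (by omega)
    rw [hlam, hpq', show n + 2 - 1 = n + 1 by omega] at h
    apply mul_left_cancel₀ hq.ne'
    linear_combination h - z (n + 3) * hbp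
  have key : ∀ i : ℕ, 1 ≤ i → z i = z 1 * (i : ℝ) * b ^ ((1 : ℤ) - (i : ℤ)) := by
    intro i hi
    obtain ⟨n, rfl⟩ := Nat.exists_eq_add_of_le' hi
    have h : b ^ n * z (n + 1) = z 1 * (n + 1) :=
      pow_mul_eq_of_double_root_recurrence (u := fun n => z (n + 1)) h0 hrec n
    rw [show (1 : ℤ) - ((n + 1 : ℕ) : ℤ) = -(n : ℤ) by push_cast; ring, zpow_neg, zpow_natCast,
      eq_mul_inv_iff_mul_eq₀ (pow_pos hb0 n).ne']
    push_cast
    linear_combination h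
  refine ⟨key, fun hpos => ⟨z 1 * b, mul_pos (hpos 1 le_rfl) hb0, fun i hi => ?_⟩⟩
  rw [key i hi, sub_eq_add_neg, zpow_add₀ hb0.ne', zpow_one]
  ring
end
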